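/- Let Ω ⊆ ℝ² be open and let u_j ∈ C^∞(Ω) satisfy |Du_j| < 1 everywhere on Ω and converge locally uniformly on Ω to a function u. Assume that for every compact set K ⊂ Ω one has sup_j ∫_K ( w_{u_j} + |D ln w_{u_j}| ) dx < ∞. Then the graph of u has no light segments: |u(y) − u(x)| < |y − x| for all x ≠ y in Ω such that the closed segment [x, y] is contained in Ω. -/

import Mathlib

open MeasureTheory Metric Set Filter
open scoped ENNReal NNReal Topology

noncomputable section

/-- The tilt function `w_u = (1 - |Du|²)^{-1/2}`. -/
noncomputable def tilt {m : ℕ} (u : EuclideanSpace ℝ (Fin m) → ℝ)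
    (x : EuclideanSpace ℝ (Fin m)) : ℝ :=
  (Real.sqrt (1 - ‖gradient u x‖ ^ 2))⁻¹

theorem ContDiffOn.gradient_of_isOpen {E : Type*} [NormedAddCommGroup E] [InnerProductSpace ℝ E]
    [CompleteSpace E] {u : E → ℝ} {Ω : Set E} {m n : WithTop ℕ∞} (hu : ContDiffOn ℝ n u Ω)
    (hΩ : IsOpen Ω) (hmn : m + 1 ≤ n) : ContDiffOn ℝ m (gradient u) Ω :=
  (InnerProductSpace.toDual ℝ E).symm.contDiff.comp_contDiffOn (hu.fderiv_of_isOpen hΩ hmn)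

theorem HasGradientAt.hasDerivAt_comp_line {E : Type*} [NormedAddCommGroup E]
    [InnerProductSpace ℝ E] [CompleteSpace E] {f : E → ℝ} {p v g : E} {t : ℝ}
    (h : HasGradientAt f g (p + t • v)) :
    HasDerivAt (fun τ : ℝ => f (p + τ • v)) (inner ℝ g v) t := by
  have hl : HasDerivAt (fun τ : ℝ => p + τ • v) v t := by
    simpa using ((hasDerivAt_id t).smul_const v).const_add p
  have := h.hasFDerivAt.comp_hasDerivAt t hl
  rwa [InnerProductSpace.toDual_apply_apply] at this

/-- One-dimensional trace inequality. -/
theorem ofReal_mul_le_lintegral_add_deriv {r : ℝ} (hr : 0 < r) {h h' : ℝ → ℝ}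
    (h0 : ∀ s ∈ Icc 0 r, 0 ≤ h s) (hd : ∀ s ∈ Icc 0 r, HasDerivAt h (h' s) s)
    (hc : ContinuousOn h' (Icc 0 r)) :
    ENNReal.ofReal (r * h 0) ≤ ∫⁻ s in Icc 0 r, ENNReal.ofReal (h s + r * |h' s|) := by
  have hch : ContinuousOn h (Icc 0 r) := fun s hs => (hd s hs).continuousAt.continuousWithinAt
  have hcd : ContinuousOn (fun s => h s - (r - s) * h' s) (Icc 0 r) := by fun_prop
  have hci : ContinuousOn (fun s => h s + r * |h' s|) (Icc 0 r) := by fun_prop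
  have ftc : ∫ s in (0 : ℝ)..r, (h s - (r - s) * h' s) = r * h 0 := by
    rw [intervalIntegral.integral_eq_sub_of_hasDerivAt (f := fun s => -((r - s) * h s))]
    · simp
    · intro s hs
      rw [uIcc_of_le hr.le] at hs
      have h1 := (((hasDerivAt_id' s).const_sub r).fun_mul (hd s hs)).fun_neg
      rwa [show -(-1 * h s + (r - s) * h' s) = h s - (r - s) * h' s by ring] at h1
    · exact ContinuousOn.intervalIntegrable (by rwa [uIcc_of_le hr.le])
  rw [← ftc, intervalIntegral.integral_of_le hr.le, ← integral_Icc_eq_integral_Ioc]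
  calc ENNReal.ofReal (∫ s in Icc 0 r, (h s - (r - s) * h' s))
      ≤ ENNReal.ofReal (∫ s in Icc 0 r, (h s + r * |h' s|)) := by
        refine ENNReal.ofReal_le_ofReal (setIntegral_mono_on hcd.integrableOn_Icc
          hci.integrableOn_Icc measurableSet_Icc fun s hs => ?_)
        have h1 : (r - s) * -h' s ≤ r * |h' s| :=
          (mul_le_mul_of_nonneg_left (neg_le_abs _) (by linarith [hs.2])).trans
            (mul_le_mul_of_nonneg_right (by linarith [hs.1]) (abs_nonneg _))
        linarith
    _ = _ := ofReal_integral_eq_lintegral_ofReal hci.integrableOn_Icc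
        ((ae_restrict_iff' measurableSet_Icc).2 (Eventually.of_forall fun s hs =>
          add_nonneg (h0 s hs) (by positivity)))

section tilt

variable {m : ℕ} {u : EuclideanSpace ℝ (Fin m) → ℝ} {x : EuclideanSpace ℝ (Fin m)}

theorem one_sub_norm_gradient_sq_pos (h : ‖gradient u x‖ < 1) : 0 < 1 - ‖gradient u x‖ ^ 2 := by
  nlinarith [norm_nonneg (gradient u x)]

theorem log_tilt (h : ‖gradient u x‖ < 1) :
    Real.log (tilt u x) = -(Real.log (1 - ‖gradient u x‖ ^ 2) / 2) := by
  rw [tilt, Real.log_inv, Real.log_sqrt (one_sub_norm_gradient_sq_pos h).le]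

theorem log_tilt_nonneg (h : ‖gradient u x‖ < 1) : 0 ≤ Real.log (tilt u x) := by
  rw [log_tilt h]
  have := Real.log_nonpos (one_sub_norm_gradient_sq_pos h).le
    (by nlinarith [norm_nonneg (gradient u x)])
  linarith

theorem tilt_pos (h : ‖gradient u x‖ < 1) : 0 < tilt u x :=
  inv_pos.2 (Real.sqrt_pos.2 (one_sub_norm_gradient_sq_pos h))

theorem log_tilt_le_tilt (h : ‖gradient u x‖ < 1) : Real.log (tilt u x) ≤ tilt u x := by
  linarith [Real.log_le_sub_one_of_pos (tilt_pos h)]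

theorem contDiffOn_tilt {Ω : Set (EuclideanSpace ℝ (Fin m))} {k n : WithTop ℕ∞} (hΩ : IsOpen Ω)
    (hu : ContDiffOn ℝ n u Ω) (hkn : k + 1 ≤ n) (hsp : ∀ x ∈ Ω, ‖gradient u x‖ < 1) :
    ContDiffOn ℝ k (tilt u) Ω := by
  have hpos : ∀ x ∈ Ω, 0 < 1 - ‖gradient u x‖ ^ 2 :=
    fun x hx => one_sub_norm_gradient_sq_pos (hsp x hx)
  exact ((contDiffOn_const.sub ((hu.gradient_of_isOpen hΩ hkn).norm_sq ℝ)).sqrt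
    fun x hx => (hpos x hx).ne').inv fun x hx => (Real.sqrt_pos.2 (hpos x hx)).ne'

/-- A lower bound for `ln w` in terms of a directional derivative, from the tangent line to the
logarithm at `a`. -/
theorem le_log_tilt (h : ‖gradient u x‖ < 1) {d : EuclideanSpace ℝ (Fin m)} {a : ℝ} (ha : 0 < a)
    (hd : d ≠ 0) :
    (1 - Real.log a) / 2 - (1 - inner ℝ (gradient u x) d / ‖d‖) / a ≤ Real.log (tilt u x) := by
  rw [log_tilt h]
  have hd' : 0 < ‖d‖ := norm_pos_iff.2 hd
  have hp : inner ℝ (gradient u x) d / ‖d‖ ≤ ‖gradient u x‖ := by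
    rw [div_le_iff₀ hd']
    exact real_inner_le_norm _ _
  set p := inner ℝ (gradient u x) d / ‖d‖
  set g := ‖gradient u x‖ with hg
  have hpos : 0 < 1 - g ^ 2 := one_sub_norm_gradient_sq_pos h
  have h1 := Real.log_le_sub_one_of_pos (div_pos hpos ha)
  rw [Real.log_div hpos.ne' ha.ne'] at h1
  have h2 : (1 - g ^ 2) / a ≤ 2 * ((1 - p) / a) := by
    rw [← mul_div_assoc]
    gcongr
    nlinarith [sq_nonneg (1 - g)]
  linarith

end tilt

/-- The tangential derivative of an almost light segment is close to `1`, which forces `ln w` to be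
large on average. -/
theorem le_integral_log_tilt {m : ℕ} {u : EuclideanSpace ℝ (Fin m) → ℝ}
    {Ω : Set (EuclideanSpace ℝ (Fin m))} (hΩ : IsOpen Ω) (hu : ContDiffOn ℝ 1 u Ω)
    (hsp : ∀ x ∈ Ω, ‖gradient u x‖ < 1) {x d : EuclideanSpace ℝ (Fin m)} (hd : d ≠ 0)
    (hseg : ∀ t ∈ Icc (0 : ℝ) 1, x + t • d ∈ Ω) {a : ℝ} (ha : 0 < a) :
    (1 - Real.log a) / 2 - (1 - (u (x + d) - u x) / ‖d‖) / a ≤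
      ∫ t in Icc (0 : ℝ) 1, Real.log (tilt u (x + t • d)) := by
  have hcg : ContinuousOn (fun t : ℝ => gradient u (x + t • d)) (Icc 0 1) :=
    (hu.gradient_of_isOpen (m := 0) hΩ (by simp)).continuousOn.comp (by fun_prop) hseg
  have hcp : ContinuousOn (fun t : ℝ => inner ℝ (gradient u (x + t • d)) d) (Icc 0 1) :=
    hcg.inner continuousOn_const
  have hcw : ContinuousOn (fun t : ℝ => Real.log (tilt u (x + t • d))) (Icc 0 1) := by
    refine ContinuousOn.log ?_ fun t ht => (tilt_pos (hsp _ (hseg t ht))).ne'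
    exact (contDiffOn_tilt (k := 0) hΩ hu (by simp) hsp).continuousOn.comp (by fun_prop) hseg
  have ftc : ∫ t in Icc (0 : ℝ) 1, inner ℝ (gradient u (x + t • d)) d = u (x + d) - u x := by
    rw [integral_Icc_eq_integral_Ioc, ← intervalIntegral.integral_of_le zero_le_one,
      intervalIntegral.integral_eq_sub_of_hasDerivAt (f := fun t : ℝ => u (x + t • d))]
    · simp
    · intro t ht
      rw [uIcc_of_le zero_le_one] at ht
      exact HasGradientAt.hasDerivAt_comp_line (((hu.differentiableOn (by simp)).differentiableAt
        (hΩ.mem_nhds (hseg t ht))).hasGradientAt)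
    · exact ContinuousOn.intervalIntegrable (by rwa [uIcc_of_le zero_le_one])
  have hi : IntegrableOn (fun t : ℝ => inner ℝ (gradient u (x + t • d)) d) (Icc 0 1) :=
    hcp.integrableOn_Icc
  calc _ = ∫ t in Icc (0 : ℝ) 1, ((1 - Real.log a) / 2
          - (1 - inner ℝ (gradient u (x + t • d)) d / ‖d‖) / a) := by
        have hc : ∀ c : ℝ, IntegrableOn (fun _ : ℝ => c) (Icc 0 1) := fun c =>
          continuousOn_const.integrableOn_Icc
        have hi' : IntegrableOn (fun t : ℝ => 1 - inner ℝ (gradient u (x + t • d)) d / ‖d‖)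
            (Icc 0 1) := (hc _).sub (hi.div_const _)
        rw [integral_sub (hc _) (hi'.div_const _), integral_div a,
          integral_sub (hc _) (hi.div_const _), integral_div ‖d‖, ftc]
        simp
    _ ≤ _ := by
        refine setIntegral_mono_on (ContinuousOn.integrableOn_Icc (by fun_prop))
          hcw.integrableOn_Icc measurableSet_Icc fun t ht => ?_
        exact le_log_tilt (hsp _ (hseg t ht)) ha hd

/-- Change of variables to affine coordinates in the plane, up to a constant Jacobian. -/
theorem exists_setLIntegral_comp_affine_eq (x : EuclideanSpace ℝ (Fin 2))
    {d n : EuclideanSpace ℝ (Fin 2)} (hdn : LinearIndependent ℝ ![d, n]) :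
    ∃ c : ℝ≥0, ∀ (G : EuclideanSpace ℝ (Fin 2) → ℝ≥0∞) (S : Set (ℝ × ℝ)),
      ∫⁻ p in S, G (x + p.1 • d + p.2 • n) =
        c * ∫⁻ z in (fun p : ℝ × ℝ => x + p.1 • d + p.2 • n) '' S, G z := by
  let L₀ : ℝ × ℝ →ₗ[ℝ] EuclideanSpace ℝ (Fin 2) :=
    (LinearMap.toSpanSingleton ℝ _ d).coprod (LinearMap.toSpanSingleton ℝ _ n)
  have hinj : Function.Injective L₀ := by
    rw [injective_iff_map_eq_zero]
    rintro ⟨s, t⟩ h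
    obtain ⟨h1, h2⟩ := LinearIndependent.pair_iff.1 hdn s t (by simpa [L₀] using h)
    simp [h1, h2]
  let L : (ℝ × ℝ) ≃L[ℝ] EuclideanSpace ℝ (Fin 2) :=
    (L₀.linearEquivOfInjective hinj (by simp)).toContinuousLinearEquiv
  have hL : (fun p : ℝ × ℝ => x + p.1 • d + p.2 • n) = (x + ·) ∘ L := by
    ext1 p
    exact add_assoc _ _ _
  have hμ : (Measure.map L (volume : Measure (ℝ × ℝ))).IsAddHaarMeasure :=
    L.isAddHaarMeasure_map volume
  refine ⟨(Measure.map L (volume : Measure (ℝ × ℝ))).addHaarScalarFactor volume, fun G S => ?_⟩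
  have hmp : MeasurePreserving (fun p : ℝ × ℝ => x + p.1 • d + p.2 • n) volume
      (Measure.map L (volume : Measure (ℝ × ℝ))) := by
    rw [hL]
    exact (measurePreserving_add_left _ x).comp (L.continuous.measurable.measurePreserving _)
  have hme : MeasurableEmbedding (fun p : ℝ × ℝ => x + p.1 • d + p.2 • n) := by
    rw [hL]
    exact (measurableEmbedding_addLeft x).comp L.toHomeomorph.measurableEmbedding
  rw [hmp.setLIntegral_comp_emb hme]
  conv_lhs => rw [Measure.isAddLeftInvariant_eq_smul (Measure.map L volume) volume]
  rw [Measure.restrict_smul, lintegral_smul_measure, ENNReal.smul_def, smul_eq_mul]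

/-- Trace inequality on a segment for a nonnegative `C¹` function in the plane. -/
theorem lintegral_trace_le {f : EuclideanSpace ℝ (Fin 2) → ℝ} {Ω : Set (EuclideanSpace ℝ (Fin 2))}
    (hΩ : IsOpen Ω) (hf : ContDiffOn ℝ 1 f Ω) (hf0 : ∀ z ∈ Ω, 0 ≤ f z)
    {x d n : EuclideanSpace ℝ (Fin 2)} {r : ℝ} (hr : 0 < r)
    (hS : ∀ p ∈ Icc (0 : ℝ) 1 ×ˢ Icc 0 r, x + p.1 • d + p.2 • n ∈ Ω) :
    ∫⁻ t in Icc (0 : ℝ) 1, ENNReal.ofReal (r * f (x + t • d)) ≤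
      ENNReal.ofReal (1 + r * ‖n‖) * ∫⁻ p in Icc (0 : ℝ) 1 ×ˢ Icc 0 r,
        ENNReal.ofReal (f (x + p.1 • d + p.2 • n) + ‖gradient f (x + p.1 • d + p.2 • n)‖) := by
  have hcg : ContinuousOn (gradient f) Ω :=
    (hf.gradient_of_isOpen (m := 0) hΩ (by simp)).continuousOn
  have hmeas : AEMeasurable (fun p : ℝ × ℝ => ENNReal.ofReal
      (f (x + p.1 • d + p.2 • n) + ‖gradient f (x + p.1 • d + p.2 • n)‖))
      (volume.restrict (Icc (0 : ℝ) 1 ×ˢ Icc 0 r)) := by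
    refine (ContinuousOn.aemeasurable ?_ (measurableSet_Icc.prod measurableSet_Icc)).ennreal_ofReal
    exact (hf.continuousOn.add hcg.norm).comp (f := fun p : ℝ × ℝ => x + p.1 • d + p.2 • n)
      (by fun_prop) hS
  rw [Measure.volume_eq_prod, ← Measure.prod_restrict] at hmeas ⊢
  rw [lintegral_prod _ hmeas, ← lintegral_const_mul' _ _ ENNReal.ofReal_ne_top]
  refine setLIntegral_mono' measurableSet_Icc fun t ht => ?_
  have hline : ∀ s ∈ Icc 0 r, x + t • d + s • n ∈ Ω := fun s hs => hS (t, s) ⟨ht, hs⟩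
  have h1 := ofReal_mul_le_lintegral_add_deriv hr (h := fun s => f (x + t • d + s • n))
    (h' := fun s => inner ℝ (gradient f (x + t • d + s • n)) n) (fun s hs => hf0 _ (hline s hs))
    (fun s hs => HasGradientAt.hasDerivAt_comp_line (((hf.differentiableOn (by simp)).differentiableAt
        (hΩ.mem_nhds (hline s hs))).hasGradientAt))
    ((hcg.comp (by fun_prop) hline).inner continuousOn_const)
  rw [zero_smul, add_zero] at h1
  refine h1.trans ?_
  rw [← lintegral_const_mul' _ _ ENNReal.ofReal_ne_top]
  refine setLIntegral_mono' measurableSet_Icc fun s hs => ?_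
  rw [← ENNReal.ofReal_mul (by positivity)]
  refine ENNReal.ofReal_le_ofReal ?_
  have h2 := mul_le_mul_of_nonneg_left
    (abs_real_inner_le_norm (gradient f (x + t • d + s • n)) n) hr.le
  have h3 : 0 ≤ r * ‖n‖ * f (x + t • d + s • n) :=
    mul_nonneg (by positivity) (hf0 _ (hline s hs))
  nlinarith [norm_nonneg (gradient f (x + t • d + s • n))]

theorem exists_linearIndependent_pair {d : EuclideanSpace ℝ (Fin 2)} (hd : d ≠ 0) :
    ∃ n : EuclideanSpace ℝ (Fin 2), LinearIndependent ℝ ![d, n] :=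
  exists_linearIndependent_pair_of_one_lt_finrank (by simp) hd

/-- A segment in an open set can be thickened to a parallelogram. -/
theorem exists_pos_parallelogram_subset {E : Type*} [NormedAddCommGroup E] [NormedSpace ℝ E]
    {Ω : Set E} (hΩ : IsOpen Ω) {x d : E} (hseg : ∀ t ∈ Icc (0 : ℝ) 1, x + t • d ∈ Ω) (n : E) :
    ∃ r > 0, ∀ p ∈ Icc (0 : ℝ) 1 ×ˢ Icc (0 : ℝ) r, x + p.1 • d + p.2 • n ∈ Ω := by
  have hK : IsCompact ((fun t : ℝ => x + t • d) '' Icc 0 1) :=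
    isCompact_Icc.image (by fun_prop)
  obtain ⟨δ, hδ, hsub⟩ := hK.exists_thickening_subset_open hΩ (image_subset_iff.2 hseg)
  refine ⟨δ / (‖n‖ + 1), by positivity, fun p hp => hsub ?_⟩
  rw [mem_thickening_iff]
  refine ⟨_, mem_image_of_mem _ hp.1, ?_⟩
  rw [dist_eq_norm, add_sub_cancel_left, norm_smul, Real.norm_of_nonneg hp.2.1]
  have h1 : p.2 * (‖n‖ + 1) ≤ δ := (le_div_iff₀ (by positivity)).1 hp.2.2
  have h2 := norm_nonneg n
  rcases hp.2.1.eq_or_lt with h | h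
  · simpa [← h] using hδ
  · linarith

/-- `∫ ln w` along a segment is bounded in terms of a planar integral of `w + |D ln w|`. -/
theorem exists_integral_log_tilt_le {Ω : Set (EuclideanSpace ℝ (Fin 2))} (hΩ : IsOpen Ω)
    {u : ℕ → EuclideanSpace ℝ (Fin 2) → ℝ} (hsm : ∀ j, ContDiffOn ℝ 2 (u j) Ω)
    (hsp : ∀ j, ∀ x ∈ Ω, ‖gradient (u j) x‖ < 1)
    (hbd : ∀ K : Set (EuclideanSpace ℝ (Fin 2)), IsCompact K → K ⊆ Ω →
      ∃ M : ℝ, ∀ j : ℕ,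
        ∫⁻ x in K, ENNReal.ofReal
            (tilt (u j) x + ‖gradient (fun y => Real.log (tilt (u j) y)) x‖)
          ≤ ENNReal.ofReal M)
    {x d : EuclideanSpace ℝ (Fin 2)} (hd : d ≠ 0)
    (hseg : ∀ t ∈ Icc (0 : ℝ) 1, x + t • d ∈ Ω) :
    ∃ B : ℝ, ∀ j, ∫ t in Icc (0 : ℝ) 1, Real.log (tilt (u j) (x + t • d)) ≤ B := by
  obtain ⟨n, hn⟩ := exists_linearIndependent_pair hd
  obtain ⟨r, hr, hS⟩ := exists_pos_parallelogram_subset hΩ hseg n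
  obtain ⟨c, hc⟩ := exists_setLIntegral_comp_affine_eq x hn
  obtain ⟨M, hM⟩ := hbd ((fun p : ℝ × ℝ => x + p.1 • d + p.2 • n) '' Icc (0 : ℝ) 1 ×ˢ Icc 0 r)
    ((isCompact_Icc.prod isCompact_Icc).image (by fun_prop)) (image_subset_iff.2 hS)
  refine ⟨(ENNReal.ofReal (1 + r * ‖n‖) * (c * ENNReal.ofReal M)).toReal / r, fun j => ?_⟩
  have hf : ContDiffOn ℝ 1 (fun y => Real.log (tilt (u j) y)) Ω :=
    (contDiffOn_tilt hΩ (hsm j) (by norm_num) (hsp j)).log fun z hz => (tilt_pos (hsp j z hz)).ne'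
  have hf0 : ∀ z ∈ Ω, 0 ≤ Real.log (tilt (u j) z) := fun z hz => log_tilt_nonneg (hsp j z hz)
  have hfc : ContinuousOn (fun t : ℝ => r * Real.log (tilt (u j) (x + t • d))) (Icc 0 1) :=
    continuousOn_const.mul (hf.continuousOn.comp (by fun_prop) hseg)
  rw [le_div_iff₀ hr, mul_comm, ← integral_const_mul,
    integral_eq_lintegral_of_nonneg_ae
      ((ae_restrict_iff' measurableSet_Icc).2 (Eventually.of_forall fun t ht =>
        mul_nonneg hr.le (hf0 _ (hseg t ht))))
      hfc.integrableOn_Icc.aestronglyMeasurable]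
  refine ENNReal.toReal_mono (by finiteness) ((lintegral_trace_le hΩ hf hf0 hr hS).trans ?_)
  gcongr
  calc _ ≤ ∫⁻ p in Icc (0 : ℝ) 1 ×ˢ Icc 0 r, ENNReal.ofReal (tilt (u j) (x + p.1 • d + p.2 • n) +
          ‖gradient (fun y => Real.log (tilt (u j) y)) (x + p.1 • d + p.2 • n)‖) := by
        refine setLIntegral_mono' (measurableSet_Icc.prod measurableSet_Icc) fun p hp => ?_
        gcongr
        exact log_tilt_le_tilt (hsp j _ (hS p hp))
    _ = c * _ := hc (fun z => ENNReal.ofReal (tilt (u j) z +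
          ‖gradient (fun y => Real.log (tilt (u j) y)) z‖)) _
    _ ≤ _ := by
        gcongr
        exact hM j

theorem sub_lt_norm_sub_of_lintegral_tilt_le {Ω : Set (EuclideanSpace ℝ (Fin 2))} (hΩ : IsOpen Ω)
    {u : ℕ → EuclideanSpace ℝ (Fin 2) → ℝ} {ulim : EuclideanSpace ℝ (Fin 2) → ℝ}
    (hsm : ∀ j, ContDiffOn ℝ 2 (u j) Ω)
    (hsp : ∀ j, ∀ x ∈ Ω, ‖gradient (u j) x‖ < 1)
    (hconv : ∀ x ∈ Ω, Tendsto (fun j => u j x) atTop (𝓝 (ulim x)))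
    (hbd : ∀ K : Set (EuclideanSpace ℝ (Fin 2)), IsCompact K → K ⊆ Ω →
      ∃ M : ℝ, ∀ j : ℕ,
        ∫⁻ x in K, ENNReal.ofReal
            (tilt (u j) x + ‖gradient (fun y => Real.log (tilt (u j) y)) x‖)
          ≤ ENNReal.ofReal M)
    {x y : EuclideanSpace ℝ (Fin 2)} (hxy : x ≠ y) (hsub : segment ℝ x y ⊆ Ω) :
    ulim y - ulim x < ‖y - x‖ := by
  have hd : y - x ≠ 0 := sub_ne_zero.2 hxy.symm
  have hd' : 0 < ‖y - x‖ := norm_pos_iff.2 hd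
  have hseg : ∀ t ∈ Icc (0 : ℝ) 1, x + t • (y - x) ∈ Ω := fun t ht =>
    hsub (segment_eq_image' ℝ x y ▸ mem_image_of_mem _ ht)
  obtain ⟨B, hB⟩ := exists_integral_log_tilt_le hΩ hsm hsp hbd hd hseg
  by_contra! hle
  have hlim : Tendsto (fun j => (u j y - u j x) / ‖y - x‖) atTop
      (𝓝 ((ulim y - ulim x) / ‖y - x‖)) :=
    ((hconv y (hsub (right_mem_segment ℝ x y))).sub
      (hconv x (hsub (left_mem_segment ℝ x y)))).div_const _
  have h1 : 1 ≤ (ulim y - ulim x) / ‖y - x‖ := (one_le_div₀ hd').2 hle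
  set a := Real.exp (1 - 2 * (B + 2)) with ha
  have ha0 : 0 < a := Real.exp_pos _
  obtain ⟨j, hj⟩ := (hlim.eventually_const_lt (show 1 - a < _ by linarith)).exists
  have h2 := (le_integral_log_tilt hΩ ((hsm j).of_le (by norm_num)) (hsp j) hd hseg ha0).trans
    (hB j)
  have h3 : (1 - (u j y - u j x) / ‖y - x‖) / a < 1 := by
    rw [div_lt_one ha0]
    linarith
  rw [add_sub_cancel, ha, Real.log_exp, ← ha] at h2
  linarith

/-- Absence of light segments for the locally uniform limit of smooth strictly spacelike
graphs in `𝕃³` with locally uniformly bounded `∫ (w + |D ln w|)`. -/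
theorem no_light_segments
    (Ω : Set (EuclideanSpace ℝ (Fin 2))) (hΩ : IsOpen Ω)
    (u : ℕ → EuclideanSpace ℝ (Fin 2) → ℝ) (ulim : EuclideanSpace ℝ (Fin 2) → ℝ)
    (hsm : ∀ j, ContDiffOn ℝ (⊤ : ℕ∞) (u j) Ω)
    (hsp : ∀ j, ∀ x ∈ Ω, ‖gradient (u j) x‖ < 1)
    (hconv : TendstoLocallyUniformlyOn u ulim atTop Ω)
    (hbd : ∀ K : Set (EuclideanSpace ℝ (Fin 2)), IsCompact K → K ⊆ Ω →
      ∃ M : ℝ, ∀ j : ℕ,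
        ∫⁻ x in K, ENNReal.ofReal
            (tilt (u j) x + ‖gradient (fun y => Real.log (tilt (u j) y)) x‖)
          ≤ ENNReal.ofReal M) :
    ∀ x ∈ Ω, ∀ y ∈ Ω, x ≠ y → segment ℝ x y ⊆ Ω → |ulim y - ulim x| < ‖y - x‖ := by
  intro x hx y hy hxy hsub
  have hsm2 : ∀ j, ContDiffOn ℝ 2 (u j) Ω := fun j =>
    (hsm j).of_le (WithTop.coe_le_coe.2 (le_top : (2 : ℕ∞) ≤ ⊤))
  have hpt : ∀ x ∈ Ω, Tendsto (fun j => u j x) atTop (𝓝 (ulim x)) :=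
    fun x hx => hconv.tendsto_at hx
  rw [abs_lt]
  constructor
  · have := sub_lt_norm_sub_of_lintegral_tilt_le hΩ hsm2 hsp hpt hbd hxy.symm
      (segment_symm ℝ x y ▸ hsub)
    rw [norm_sub_rev] at this
    linarith
  · exact sub_lt_norm_sub_of_lintegral_tilt_le hΩ hsm2 hsp hpt hbd hxy hsub
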